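/- Let b(n) denote the number of partition triples π = (π₁, π₂, π₃) of n such that π₁ consists of distinct odd parts, and π₂ and π₃ consist of parts divisible by 4 (with b(0) = 1). Then for all n ≥ 0, b(81n + 24) ≡ −b(9n + 3) (mod 3). -/

import Mathlib

open PowerSeries

/-- `bTriple n` is the number of partition triples `(π₁, π₂, π₃)` of `n` such that
`π₁` has distinct odd parts and all parts of `π₂` and `π₃` are (positive and)
divisible by `4`. -/
noncomputable def bTriple (n : ℕ) : ℕ :=
  Nat.card {t : Multiset ℕ × Multiset ℕ × Multiset ℕ //
    t.1.sum + t.2.1.sum + t.2.2.sum = n ∧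
    t.1.Nodup ∧ (∀ x ∈ t.1, Odd x) ∧
    (∀ x ∈ t.2.1, 0 < x ∧ 4 ∣ x) ∧
    (∀ x ∈ t.2.2, 0 < x ∧ 4 ∣ x)}


namespace BT
open Filter Topology
open scoped PowerSeries.WithPiTopology

abbrev S := PowerSeries (ZMod 3)

instance : Fact (Nat.Prime 3) := ⟨Nat.prime_three⟩
instance : CharP S 3 := by
  exact charP_of_injective_ringHom (f := (C : ZMod 3 →+* S)) (PowerSeries.C_injective) 3

noncomputable def fac (ε : ZMod 3) (a c n : ℕ) : S := 1 + C ε * X ^ (c * n + a)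

noncomputable def E (ε : ZMod 3) (a c : ℕ) : S := ∏' n, fac ε a c n

lemma fac_mult (ε : ZMod 3) (a c : ℕ) (hc : 0 < c) : Multipliable (fac ε a c) := by
  apply WithPiTopology.multipliable_one_add_of_tendsto_order_atTop_nhds_top
  refine ENat.tendsto_nhds_top_iff_natCast_lt.mpr (fun n ↦ Filter.eventually_atTop.mpr ⟨n+1, ?_⟩)
  intro m hm
  grw [← le_order_mul, order_X_pow]
  refine lt_add_of_nonneg_of_lt (by simp) ?_
  norm_cast
  nlinarith

lemma E_hasProd (ε : ZMod 3) (a c : ℕ) (hc : 0 < c) : HasProd (fac ε a c) (E ε a c) :=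
  (fac_mult ε a c hc).hasProd

lemma E_tendsto (ε : ZMod 3) (a c : ℕ) (hc : 0 < c) :
    Tendsto (fun N => ∏ n ∈ Finset.range N, fac ε a c n) atTop (𝓝 (E ε a c)) :=
  (E_hasProd ε a c hc).tendsto_prod_nat

lemma E_split2 (ε : ZMod 3) (a c : ℕ) (hc : 0 < c) :
    E ε a c = E ε a (2*c) * E ε (a+c) (2*c) := by
  have h1 := (E_tendsto ε a c hc).comp (tendsto_id.const_mul_atTop' (show 0 < 2 by norm_num))
  have h2 := (E_tendsto ε a (2*c) (by omega)).mul (E_tendsto ε (a+c) (2*c) (by omega))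
  refine tendsto_nhds_unique h1 (h2.congr ?_)
  intro N
  simp only [Function.comp, id]
  induction N with
  | zero => simp
  | succ N ih =>
    rw [Nat.mul_succ, Finset.prod_range_succ, Finset.prod_range_succ, Finset.prod_range_succ,
      Finset.prod_range_succ, ← ih]
    have e1 : fac ε a (2*c) N = fac ε a c (2*N) := by unfold fac; congr 3; ring
    have e2 : fac ε (a+c) (2*c) N = fac ε a c (2*N+1) := by unfold fac; congr 3; ring
    rw [e1, e2]; ring

lemma E_split3 (ε : ZMod 3) (a c : ℕ) (hc : 0 < c) :
    E ε a c = E ε a (3*c) * E ε (a+c) (3*c) * E ε (a+2*c) (3*c) := by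
  have h1 := (E_tendsto ε a c hc).comp (tendsto_id.const_mul_atTop' (show 0 < 3 by norm_num))
  have h2 := ((E_tendsto ε a (3*c) (by omega)).mul (E_tendsto ε (a+c) (3*c) (by omega))).mul
    (E_tendsto ε (a+2*c) (3*c) (by omega))
  refine tendsto_nhds_unique h1 (h2.congr ?_)
  intro N
  simp only [Function.comp, id]
  induction N with
  | zero => simp
  | succ N ih =>
    rw [Nat.mul_succ, Finset.prod_range_succ, Finset.prod_range_succ, Finset.prod_range_succ,
      Finset.prod_range_succ, Finset.prod_range_succ, Finset.prod_range_succ, ← ih]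
    have e1 : fac ε a (3*c) N = fac ε a c (3*N) := by unfold fac; congr 3; ring
    have e2 : fac ε (a+c) (3*c) N = fac ε a c (3*N+1) := by unfold fac; congr 3; ring
    have e3 : fac ε (a+2*c) (3*c) N = fac ε a c (3*N+2) := by unfold fac; congr 3; ring
    rw [e1, e2, e3]; ring

lemma E_pm (a c : ℕ) (hc : 0 < c) : E 1 a c * E (-1) a c = E (-1) (2*a) (2*c) := by
  have h1 := (E_tendsto 1 a c hc).mul (E_tendsto (-1) a c hc)
  refine tendsto_nhds_unique h1 ((E_tendsto (-1) (2*a) (2*c) (by omega)).congr ?_)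
  intro N
  rw [← Finset.prod_mul_distrib]
  refine Finset.prod_congr rfl fun n _ => ?_
  unfold fac
  rw [show 2*c*n+2*a = (c*n+a)+(c*n+a) by ring, pow_add]
  simp only [map_neg, map_one]; ring

lemma C_cube (ε : ZMod 3) : (C ε : S)^3 = C ε := by
  rw [← map_pow]; congr 1; revert ε; decide

lemma E_cube (ε : ZMod 3) (a c : ℕ) (hc : 0 < c) : E ε (3*a) (3*c) = E ε a c ^ 3 := by
  have h1 := (E_tendsto ε a c hc).pow 3
  refine tendsto_nhds_unique (E_tendsto ε (3*a) (3*c) (by omega)) (h1.congr ?_)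
  intro N
  rw [← Finset.prod_pow]
  refine Finset.prod_congr rfl fun n _ => ?_
  unfold fac
  rw [add_pow_char, mul_pow, C_cube, one_pow, ← pow_mul]
  congr 3; ring

lemma fac_dvd (ε : ZMod 3) (a c n : ℕ) : (X : S) ^ (c*n+a) ∣ fac ε a c n - 1 := by
  unfold fac; simp

/-- congruence helper -/
lemma dvd_mul_sub_one {d a b : S} (h : d ∣ b - 1) : d ∣ a * b - a := by
  have : a * b - a = a * (b-1) := by ring
  rw [this]; exact h.mul_left _

lemma prod_dvd (ε : ZMod 3) (a c N M : ℕ) (h : N ≤ M) :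
    (X : S) ^ (c*N+a) ∣ ∏ n ∈ Finset.range M, fac ε a c n - ∏ n ∈ Finset.range N, fac ε a c n := by
  induction M, h using Nat.le_induction with
  | base => simp
  | succ M h ih =>
    rw [Finset.prod_range_succ]
    have := dvd_mul_sub_one (a := ∏ n ∈ Finset.range M, fac ε a c n)
      ((pow_dvd_pow (X : S) (show c*N+a ≤ c*M+a by gcongr)).trans (fac_dvd ε a c M))
    have := dvd_add this ih
    simpa using this

lemma E_dvd (ε : ZMod 3) (a c N : ℕ) (hc : 0 < c) :
    (X : S) ^ (c*N+a) ∣ E ε a c - ∏ n ∈ Finset.range N, fac ε a c n := by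
  rw [X_pow_dvd_iff]
  intro m hm
  have h1 := (WithPiTopology.tendsto_iff_coeff_tendsto _ _ _ _).1 ((E_tendsto ε a c hc).sub_const (∏ n ∈ Finset.range N, fac ε a c n)) m
  refine tendsto_nhds_unique h1 (tendsto_const_nhds.congr' ?_)
  filter_upwards [eventually_ge_atTop N] with M hM
  exact ((X_pow_dvd_iff.1 (prod_dvd ε a c N M hM)) m hm).symm

lemma E_const (ε : ZMod 3) (a c : ℕ) (ha : 0 < a) (hc : 0 < c) : constantCoeff (E ε a c) = 1 := by
  have := X_pow_dvd_iff.1 (E_dvd ε a c 0 hc) 0 (by omega)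
  simpa [sub_eq_zero] using this

def tri (k : ℤ) : ℕ := (k * (k+1) / 2).toNat

lemma tri_spec (k : ℤ) : (tri k : ℤ) * 2 = k * (k+1) := by
  have h : (2:ℤ) ∣ k * (k+1) := (Int.even_mul_succ_self k).two_dvd
  have h0 : 0 ≤ k * (k+1) := by
    rcases le_or_gt 0 k with h | h
    · positivity
    · nlinarith
  unfold tri
  rw [Int.toNat_of_nonneg (by omega)]
  omega

def ex (a b : ℕ) (k : ℤ) : ℕ := a * tri k + b * tri (k-1)

lemma ex_spec (a b : ℕ) (k : ℤ) : (ex a b k : ℤ) * 2 = a * (k*(k+1)) + b * (k*(k-1)) := by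
  unfold ex
  push_cast
  have h1 := tri_spec k
  have h2 := tri_spec (k-1)
  linear_combination (a:ℤ) * h1 + b * h2

lemma ex_ge (a b : ℕ) (ha : 0 < a) (hb : 0 < b) (k : ℤ) : k.natAbs ≤ ex a b k := by
  have h1 := tri_spec k
  have h2 := tri_spec (k-1)
  have : k.natAbs ≤ tri k + tri (k-1) := by
    zify
    rcases abs_cases k with ⟨h, _⟩ | ⟨h, _⟩ <;> rw [h] <;> nlinarith
  unfold ex
  nlinarith

noncomputable def term (ε : (ZMod 3)ˣ) (a b : ℕ) (k : ℤ) : S :=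
  C ((ε^k : (ZMod 3)ˣ) : ZMod 3) * X ^ (ex a b k)

/-- finite q-Pochhammer -/
noncomputable def pp (c n : ℕ) : S := ∏ i ∈ Finset.range n, fac (-1) c c i

lemma pp_succ (c n : ℕ) : pp c (n+1) = pp c n * (1 - X^(c*(n+1))) := by
  unfold pp
  rw [Finset.prod_range_succ]; congr 1
  unfold fac; rw [Nat.mul_succ]; simp; ring

lemma pp_const (c n : ℕ) (hc : 0 < c) : constantCoeff (pp c n) = 1 := by
  induction n with
  | zero => simp [pp]
  | succ n ih => rw [pp_succ]; simp [ih, hc.ne']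

noncomputable def D (c i j : ℕ) : S := pp c (i+j) * (pp c i)⁻¹ * (pp c j)⁻¹

lemma pp_inv (c n : ℕ) (hc : 0 < c) : pp c n * (pp c n)⁻¹ = 1 :=
  PowerSeries.mul_inv_cancel _ (by rw [pp_const c n hc]; simp)

lemma pp_ne (c n : ℕ) (hc : 0 < c) : pp c n ≠ 0 := by
  intro h; have := pp_const c n hc; rw [h] at this; simp at this

lemma D_spec (c i j : ℕ) (hc : 0 < c) : D c i j * (pp c i * pp c j) = pp c (i+j) := by
  unfold D
  linear_combination (pp c (i+j)) * (pp_inv c i hc) * (pp c j * (pp c j)⁻¹) + (pp c (i+j)) * (pp_inv c j hc)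

lemma D_zero_left (c j : ℕ) (hc : 0 < c) : D c 0 j = 1 := by
  have := D_spec c 0 j hc
  apply mul_right_cancel₀ (mul_ne_zero (pp_ne c 0 hc) (pp_ne c j hc))
  rw [this]; simp [pp]

lemma D_symm (c i j : ℕ) : D c i j = D c j i := by unfold D; rw [add_comm]; ring

lemma D_rec (c i j : ℕ) (hc : 0 < c) :
    D c (i+1) (j+1) = D c (i+1) j + X^(c*(j+1)) * D c i (j+1) := by
  apply mul_right_cancel₀ (mul_ne_zero (pp_ne c (i+1) hc) (pp_ne c (j+1) hc))
  have h1 := D_spec c (i+1) (j+1) hc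
  have h2 := D_spec c (i+1) j hc
  have h3 := D_spec c i (j+1) hc
  rw [h1]
  have e1 := pp_succ c i
  have e2 := pp_succ c j
  have e3 := pp_succ c (i+1+j)
  rw [show i+1+(j+1) = i+1+j+1 by ring, e3]
  rw [show i+(j+1) = i+1+j by ring] at h3
  have h2' : D c (i+1) j * (pp c (i+1) * pp c (j+1)) = pp c (i+1+j) * (1 - X^(c*(j+1))) := by
    rw [e2, ← h2]; ring
  have h3' : D c i (j+1) * (pp c (i+1) * pp c (j+1)) = pp c (i+1+j) * (1 - X^(c*(i+1))) := by
    rw [e1, ← h3]; ring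
  rw [add_mul, h2', mul_assoc, h3']
  have : (X:S)^(c*(i+1+j+1)) = X^(c*(j+1)) * X^(c*(i+1)) := by rw [← pow_add]; congr 1; ring
  rw [this]; ring

lemma D_rec' (c i j : ℕ) (hc : 0 < c) :
    D c (i+1) (j+1) = D c i (j+1) + X^(c*(i+1)) * D c (i+1) j := by
  rw [D_symm, D_rec c j i hc, D_symm, D_symm c j]

/-- multiplication by a linear factor, abstract form -/
lemma sum_step (n : ℕ) (u v w : ℕ → S) (z : S) (h0 : w 0 = u 0)
    (hs : ∀ i < n, w (i+1) = u (i+1) + v i) (hl : w (n+1) = v n)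
    (hv : ∀ i ≤ n, v i = u i * z) :
    (∑ i ∈ Finset.range (n+1), u i) * (1 + z) = ∑ i ∈ Finset.range (n+2), w i := by
  rw [Finset.sum_range_succ _ (n+1), Finset.sum_range_succ' w n, hl, h0,
    Finset.sum_congr rfl (fun i hi => hs i (Finset.mem_range.1 hi)), Finset.sum_add_distrib,
    mul_add, mul_one, Finset.sum_mul, Finset.sum_range_succ' u n,
    ← Finset.sum_congr rfl (fun i hi => hv i (by have := Finset.mem_range.1 hi; omega)),
    Finset.sum_range_succ v n]
  ring

lemma term_x (ε : (ZMod 3)ˣ) (a b : ℕ) (k : ℤ) (M j : ℕ) (h : (M:ℤ) - k = j) :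
    term ε a b k * (C (ε : ZMod 3) * X ^ ((a+b)*M+a)) = term ε a b (k+1) * X^((a+b)*j) := by
  unfold term
  rw [zpow_add_one, Units.val_mul, map_mul]
  have : (X:S) ^ ex a b k * X^((a+b)*M+a) = X ^ ex a b (k+1) * X^((a+b)*j) := by
    rw [← pow_add, ← pow_add]; congr 1
    have h1 := ex_spec a b k
    have h2 := ex_spec a b (k+1)
    have hM : (M:ℤ) = k + j := by omega
    zify
    rw [hM]
    linarith
  linear_combination (C ((ε^k : (ZMod 3)ˣ) : ZMod 3) * C (ε : ZMod 3) : S) * this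

lemma eps_sq (ε : (ZMod 3)ˣ) : ε⁻¹ = ε := by revert ε; decide

lemma term_y (ε : (ZMod 3)ˣ) (a b : ℕ) (k : ℤ) (N i : ℕ) (h : (N:ℤ) + k = i) :
    term ε a b k * (C (ε : ZMod 3) * X ^ ((a+b)*N+b)) = term ε a b (k-1) * X^((a+b)*i) := by
  unfold term
  rw [zpow_sub_one, Units.val_mul, map_mul, eps_sq]
  have : (X:S) ^ ex a b k * X^((a+b)*N+b) = X ^ ex a b (k-1) * X^((a+b)*i) := by
    rw [← pow_add, ← pow_add]; congr 1
    have h1 := ex_spec a b k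
    have h2 := ex_spec a b (k-1)
    have hM : (N:ℤ) = i - k := by omega
    zify
    rw [hM]
    linarith
  linear_combination (C ((ε^k : (ZMod 3)ˣ) : ZMod 3) * C (ε : ZMod 3) : S) * this

lemma finJTP (ε : (ZMod 3)ˣ) (a b : ℕ) (ha : 0 < a) (M N : ℕ) :
    (∏ n ∈ Finset.range M, fac ε a (a+b) n) * (∏ n ∈ Finset.range N, fac ε b (a+b) n)
      = ∑ i ∈ Finset.range (M+N+1), D (a+b) i (M+N-i) * term ε a b ((i:ℤ) - N) := by
  have hc : 0 < a + b := by omega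
  have hD0 : ∀ j, D (a+b) 0 j = 1 := fun j => D_zero_left _ j hc
  have hD0' : ∀ j, D (a+b) j 0 = 1 := fun j => by rw [D_symm, hD0]
  induction M with
  | zero =>
    induction N with
    | zero => simp [hD0, term, ex, tri]
    | succ N ih =>
      rw [Finset.prod_range_succ, ← mul_assoc, ih]
      simp only [Nat.zero_add]
      rw [fac, ← Finset.sum_range_reflect _ (N+1), ← Finset.sum_range_reflect _ (N+1+1)]
      apply sum_step _ _ (fun i => D (a+b) (N-i) i * (term ε a b (((N-i:ℕ):ℤ) - N) * (C (ε : ZMod 3) * X ^ ((a+b)*N+b))))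
      · simp [hD0']
      · intro i hi
        obtain ⟨m, rfl⟩ : ∃ m, N = i + 1 + m := ⟨N - i - 1, by omega⟩
        rw [term_y ε a b _ _ (m+1) (by push_cast; omega)]
        rw [show i+1+m+1+1-1-(i+1) = m+1 by omega, show i+1+m+1-1-(i+1) = m by omega,
          show i+1+m-i = m+1 by omega, show i+1+m+1-(m+1) = i+1 by omega,
          show i+1+m-m = i+1 by omega]
        rw [D_rec' _ _ _ hc]
        have e1 : (((m+1:ℕ):ℤ) - ((i+1+m+1:ℕ):ℤ)) = (m:ℤ) - ((i+1+m:ℕ):ℤ) := by push_cast; ring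
        have e2 : (((m+1:ℕ):ℤ) - ((i+1+m:ℕ):ℤ) - 1) = (m:ℤ) - ((i+1+m:ℕ):ℤ) := by push_cast; ring
        rw [e1, e2]; ring
      · rw [term_y ε a b _ _ 0 (by simp)]
        simp [hD0]
        congr 1; ring
      · intro i hi
        rw [show N+1-1-i = N-i by omega, show N-(N-i) = i by omega, mul_assoc]
  | succ M ih =>
    rw [Finset.prod_range_succ, mul_right_comm, ih]
    rw [fac, show M+1+N+1 = M+N+2 by ring]
    apply sum_step _ _ (fun i => D (a+b) i (M+N-i) * (term ε a b ((i:ℤ) - N) * (C (ε : ZMod 3) * X ^ ((a+b)*M+a))))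
    · simp [hD0]
    · intro i hi
      obtain ⟨m, hm⟩ : ∃ m, M + N = i + 1 + m := ⟨M + N - i - 1, by omega⟩
      rw [term_x ε a b _ _ (m+1) (by push_cast; omega)]
      rw [show M+1+N-(i+1) = m+1 by omega, show M+N-(i+1) = m by omega,
          show M+N-i = m+1 by omega, D_rec _ _ _ hc]
      have e1 : (((i+1:ℕ):ℤ) - (N:ℤ)) = (i:ℤ) - N + 1 := by push_cast; ring
      rw [e1]; ring
    · rw [term_x ε a b _ _ 0 (by push_cast; ring)]
      rw [show M+1+N-(M+N+1) = 0 by omega, show M+N-(M+N) = 0 by omega, hD0', hD0']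
      simp
      congr 1; ring
    · intro i hi
      rw [mul_assoc]

lemma D_dvd (c i j m : ℕ) (hc : 0 < c) (hi : m ≤ i) (hj : m ≤ j) :
    (X:S)^(c*(m+1)) ∣ D c i j * E (-1) c c - 1 := by
  have hE : (X:S)^(c*(m+1)) ∣ E (-1) c c - pp c i := by
    refine dvd_trans (pow_dvd_pow _ ?_) (E_dvd (-1) c c i hc)
    nlinarith
  have hp : (X:S)^(c*(m+1)) ∣ pp c (i+j) - pp c j := by
    refine dvd_trans (pow_dvd_pow _ ?_) (prod_dvd (-1) c c j (i+j) (by omega))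
    nlinarith
  have : D c i j * E (-1) c c - 1 =
      (pp c (i+j) * (E (-1) c c - pp c i) + (pp c (i+j) - pp c j) * pp c i)
        * ((pp c i)⁻¹ * (pp c j)⁻¹) := by
    unfold D
    linear_combination (pp_inv c i hc) * (pp c j * (pp c j)⁻¹) + (pp_inv c j hc)
  rw [this]
  exact Dvd.dvd.mul_right (dvd_add (hE.mul_left _) (hp.mul_right _)) _

lemma term_dvd (ε : (ZMod 3)ˣ) (a b : ℕ) (ha : 0 < a) (hb : 0 < b) (k : ℤ) :
    (X:S)^(k.natAbs) ∣ term ε a b k := by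
  unfold term
  exact Dvd.dvd.mul_left (pow_dvd_pow _ (ex_ge a b ha hb k)) _

lemma mul_cong {d p p' q q' : S} (h1 : d ∣ p - p') (h2 : d ∣ q - q') : d ∣ p * q - p' * q' := by
  have : p * q - p' * q' = (p - p') * q + p' * (q - q') := by ring
  rw [this]
  exact dvd_add (h1.mul_right _) (h2.mul_left _)

lemma jtp_cong (ε : (ZMod 3)ˣ) (a b : ℕ) (ha : 0 < a) (hb : 0 < b) (d : ℕ) :
    (X:S)^(d+1) ∣ E ε a (a+b) * E ε b (a+b) * E (-1) (a+b) (a+b)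
      - ∑ i ∈ Finset.range (d+d+1), term ε a b ((i:ℤ) - d) := by
  have hc : 0 < a+b := by omega
  have h1 : (X:S)^(d+1) ∣ E ε a (a+b) - ∏ n ∈ Finset.range d, fac ε a (a+b) n := by
    refine dvd_trans (pow_dvd_pow _ ?_) (E_dvd _ a (a+b) d hc)
    nlinarith
  have h2 : (X:S)^(d+1) ∣ E ε b (a+b) - ∏ n ∈ Finset.range d, fac ε b (a+b) n := by
    refine dvd_trans (pow_dvd_pow _ ?_) (E_dvd _ b (a+b) d hc)
    nlinarith
  have h3 := mul_cong (mul_cong h1 h2) (by simp : (X:S)^(d+1) ∣ E (-1) (a+b) (a+b) - E (-1) (a+b) (a+b))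
  rw [finJTP ε a b ha] at h3
  have h4 : (X:S)^(d+1) ∣ (∑ i ∈ Finset.range (d+d+1), D (a+b) i (d+d-i) * term ε a b ((i:ℤ) - d)) * E (-1) (a+b) (a+b) - ∑ i ∈ Finset.range (d+d+1), term ε a b ((i:ℤ) - d) := by
    rw [Finset.sum_mul, ← Finset.sum_sub_distrib]
    refine Finset.dvd_sum fun i hi => ?_
    have hi := Finset.mem_range.1 hi
    have e : D (a+b) i (d+d-i) * term ε a b ((i:ℤ) - d) * E (-1) (a+b) (a+b) - term ε a b ((i:ℤ) - d)
      = (D (a+b) i (d+d-i) * E (-1) (a+b) (a+b) - 1) * term ε a b ((i:ℤ) - d) := by ring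
    rw [e]
    obtain ⟨k, hk⟩ : ∃ k : ℕ, k = ((i:ℤ) - d).natAbs := ⟨_, rfl⟩
    have := mul_dvd_mul (D_dvd (a+b) i (d+d-i) (d - k) hc (by omega) (by omega))
      (term_dvd ε a b ha hb ((i:ℤ) - d))
    rw [← pow_add] at this
    refine dvd_trans (pow_dvd_pow _ ?_) this
    rw [← hk]
    obtain ⟨m, hm⟩ : ∃ m, d = k + m := ⟨d - k, by omega⟩
    rw [show d - k = m by omega]
    nlinarith
  have h5 := dvd_add h3 h4
  simpa using h5

noncomputable def Th (ε : (ZMod 3)ˣ) (a b : ℕ) : S :=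
  E ε a (a+b) * E ε b (a+b) * E (-1) (a+b) (a+b)

lemma jtp (ε : (ZMod 3)ˣ) (a b : ℕ) (ha : 0 < a) (hb : 0 < b) :
    HasSum (term ε a b) (Th ε a b) := by
  unfold Th
  rw [WithPiTopology.hasSum_iff_hasSum_coeff]
  intro d
  have h := X_pow_dvd_iff.1 (jtp_cong ε a b ha hb d) d (by omega)
  rw [map_sub, sub_eq_zero, map_sum] at h
  rw [h]
  have hinj : Set.InjOn (fun i : ℕ => (i:ℤ) - d) (Finset.range (d+d+1)) := by
    intro x _ y _ hxy; simpa using hxy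
  rw [← Finset.sum_image (f := fun k => coeff d (term ε a b k)) hinj]
  apply hasSum_sum_of_ne_finset_zero
  intro k hk
  refine X_pow_dvd_iff.1 (term_dvd ε a b ha hb k) d ?_
  by_contra hlt
  apply hk
  rw [Finset.mem_image]
  exact ⟨(k + d).toNat, by rw [Finset.mem_range]; omega, by omega⟩

lemma summ (g : ℤ → S) (h : ∀ k : ℤ, (X:S)^(k.natAbs) ∣ g k) : Summable g := by
  rw [WithPiTopology.summable_iff_summable_coeff]
  intro d
  apply summable_of_ne_finset_zero (s := Finset.Icc (-(d:ℤ)) d)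
  intro k hk
  refine X_pow_dvd_iff.1 (h k) d ?_
  rw [Finset.mem_Icc] at hk
  omega

lemma split_n (n : ℕ) [NeZero n] (g : ℤ → S) (t : S) (hg : HasSum g t) (u : Fin n → S)
    (hu : ∀ j : Fin n, HasSum (fun i : ℤ => g (i * n + ((j : ℕ) : ℤ))) (u j)) : t = ∑ j, u j := by
  have h1 := ((Equiv.prodComm _ _).trans (Int.divModEquiv n).symm).hasSum_iff.2 hg
  have h2 := h1.prod_fiberwise (g := u) (fun j => by
    convert! hu j using 2)
  exact h2.unique (hasSum_fintype u)

lemma split2 {g : ℤ → S} {t u0 u1 : S} (hg : HasSum g t)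
    (h0 : HasSum (fun i : ℤ => g (2*i)) u0)
    (h1 : HasSum (fun i : ℤ => g (2*i+1)) u1) : t = u0 + u1 := by
  have := split_n 2 g t hg ![u0, u1] (by
    intro j; fin_cases j
    · simpa [mul_comm] using h0
    · simpa [mul_comm] using h1)
  simpa using this

lemma split3 {g : ℤ → S} {t u0 u1 u2 : S} (hg : HasSum g t)
    (h0 : HasSum (fun i : ℤ => g (3*i)) u0)
    (h1 : HasSum (fun i : ℤ => g (3*i+1)) u1)
    (h2 : HasSum (fun i : ℤ => g (3*i+2)) u2) : t = u0 + u1 + u2 := by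
  have := split_n 3 g t hg ![u0, u1, u2] (by
    intro j; fin_cases j
    · simpa [mul_comm] using h0
    · simpa [mul_comm] using h1
    · simpa [mul_comm] using h2)
  simpa [Fin.sum_univ_three] using this

lemma hasSum_cube {g : ℤ → S} {t : S} (h : HasSum g t) : HasSum (fun k => g k ^ 3) (t^3) := by
  have := h.map (frobenius S 3) (by
    show Continuous (fun x : S => x^3)
    exact continuous_pow 3)
  simpa [Function.comp_def, frobenius_def] using this

lemma hasSum_neg {g : ℤ → S} {t : S} (h : HasSum g t) : HasSum (fun k => g (-k)) t :=
  (Equiv.neg ℤ).hasSum_iff.2 h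

lemma term_one (a b : ℕ) (k : ℤ) : term 1 a b k = X ^ (ex a b k) := by simp [term]

lemma term_cube (ε : (ZMod 3)ˣ) (a b : ℕ) (k : ℤ) :
   term ε a b k ^ 3 = C ((ε^k : (ZMod 3)ˣ) : ZMod 3) * X ^ (3 * ex a b k) := by
  rw [term, mul_pow, C_cube, ← pow_mul, mul_comm 3]

/-- φ dissection -/
lemma phi_dis : Th 1 1 1 = (Th 1 1 1)^9 - X * (Th 1 1 5)^3 := by
  have hφ := jtp 1 1 1 (by norm_num) (by norm_num)
  have hB := jtp 1 1 5 (by norm_num) (by norm_num)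
  have h9 := hasSum_cube (hasSum_cube hφ)
  have hB3 := (hasSum_cube hB).mul_left X
  have := split3 hφ (u0 := (Th 1 1 1)^9) (u1 := X * (Th 1 1 5)^3) (u2 := X * (Th 1 1 5)^3) ?_ ?_ ?_
  · have h3 : (3:S) = 0 := by exact_mod_cast CharP.cast_eq_zero S 3
    linear_combination this + X * (Th 1 1 5)^3 * h3
  · convert! h9 using 1
    · funext i
      simp only [term_one, ← pow_mul]; congr 1
      have h1 := ex_spec 1 1 (3*i); have h2 := ex_spec 1 1 i
      zify; push_cast at *; linarith
    · rw [← pow_mul]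
  · convert! hasSum_neg hB3 using 1
    funext i
    simp only [term_one, ← pow_mul, ← pow_succ']; congr 1
    have h1 := ex_spec 1 1 (3*i+1); have h2 := ex_spec 1 5 (-i)
    zify; push_cast at *; linarith
  · have := (Equiv.addRight (1:ℤ)).hasSum_iff.2 hB3
    convert! this using 1
    funext i
    simp only [term_one, ← pow_mul, ← pow_succ', Function.comp, Equiv.coe_addRight]; congr 1
    have h1 := ex_spec 1 1 (3*i+2); have h2 := ex_spec 1 5 (i+1)
    zify; push_cast at *; linarith

lemma psi_dis : Th 1 1 3 = (Th 1 1 2)^3 + X * (Th 1 1 3)^9 := by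
  have hψ := jtp 1 1 3 (by norm_num) (by norm_num)
  have hA := hasSum_cube (jtp 1 1 2 (by norm_num) (by norm_num))
  have h9 := (hasSum_cube (hasSum_cube hψ)).mul_left X
  have s0 : Summable (fun i : ℤ => term 1 1 3 (3*i)) := by
    apply summ
    intro k
    refine (pow_dvd_pow _ ?_).trans (term_dvd 1 1 3 (by norm_num) (by norm_num) _)
    omega
  have s2 : Summable (fun i : ℤ => term 1 1 3 (3*i+2)) := by
    apply summ
    intro k
    refine (pow_dvd_pow _ ?_).trans (term_dvd 1 1 3 (by norm_num) (by norm_num) _)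
    omega
  have e1 := split3 hψ (u1 := X * (Th 1 1 3)^9) s0.hasSum ?_ s2.hasSum
  have e2 := split2 (u0 := ∑' i : ℤ, term 1 1 3 (3*i)) (u1 := ∑' i : ℤ, term 1 1 3 (3*i+2)) hA ?_ ?_
  · rw [e2]; linear_combination e1
  · convert! s0.hasSum using 1
    funext i
    simp only [term_one, ← pow_mul]; congr 1
    have h1 := ex_spec 1 2 (2*i); have h2 := ex_spec 1 3 (3*i)
    zify; push_cast at *; linarith
  · have := (((Equiv.neg ℤ).trans (Equiv.addRight (-1:ℤ)))).hasSum_iff.2 s2.hasSum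
    convert! this using 1
    funext i
    simp only [term_one, ← pow_mul, Function.comp, Equiv.coe_addRight, Equiv.trans_apply, Equiv.neg_apply]; congr 1
    have h1 := ex_spec 1 2 (2*i+1); have h2 := ex_spec 1 3 (3*(-i+-1)+2)
    zify; push_cast at *; linarith
  · rw [← pow_mul] at h9
    have h9' := hasSum_neg h9
    refine (funext fun i => ?_ : (fun i : ℤ => term 1 1 3 (3*i+1)) = _) ▸ h9'
    simp only [term_one, ← pow_mul, ← pow_succ']; congr 1
    have h1 := ex_spec 1 3 (3*i+1); have h2 := ex_spec 1 3 (-i)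
    zify; push_cast at *; linarith

lemma P2_dis : ∃ R : S, Th (-1) 2 2 = (Th (-1) 2 2)^9 + X^2 * R^3 := by
  have hφ := jtp (-1) 2 2 (by norm_num) (by norm_num)
  have h9 := hasSum_cube (hasSum_cube hφ)
  have hr : ∀ i : ℤ, (6 * i * i + 4 * i).toNat = (6 * i * i + 4 * i) := by
    intro i
    apply Int.toNat_of_nonneg
    rcases le_or_gt 0 i with h | h <;> nlinarith
  let r : ℤ → S := fun i => C (((-1)^i : (ZMod 3)ˣ) : ZMod 3) * X ^ (6 * i * i + 4 * i).toNat
  have sr : Summable r := by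
    apply summ
    intro k
    refine Dvd.dvd.mul_left (pow_dvd_pow _ ?_) _
    zify; rw [hr]
    rcases abs_cases k with ⟨h, _⟩ | ⟨h, _⟩ <;> rw [h] <;> nlinarith
  have hr3 := (hasSum_cube sr.hasSum).mul_left (X^2 : S)
  have hc : ∀ i, r i ^ 3 = C (((-1)^i : (ZMod 3)ˣ) : ZMod 3) * X ^ (3 * (6 * i * i + 4 * i).toNat) := by
    intro i
    simp only [r]
    rw [mul_pow, C_cube, ← pow_mul, mul_comm 3]
  have := split3 hφ (u0 := (Th (-1) 2 2)^9) (u1 := -(X^2 * (∑' i, r i)^3)) (u2 := -(X^2 * (∑' i, r i)^3)) ?_ ?_ ?_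
  · exact ⟨∑' i, r i, by 
      have h3 : (3:S) = 0 := by exact_mod_cast CharP.cast_eq_zero S 3
      linear_combination this - X^2 * (∑' i, r i)^3 * h3⟩
  · convert! h9 using 1
    · funext i
      simp only [term_cube]
      rw [mul_pow, C_cube, ← pow_mul, term]
      congr 2
      · congr 1
        rw [zpow_mul]; rfl
      · have h1 := ex_spec 2 2 (3*i); have h2 := ex_spec 2 2 i
        zify; push_cast at *; linarith
    · rw [← pow_mul]
  · convert! hr3.neg using 1
    funext i
    rw [hc, term, zpow_add_one, zpow_mul, show ((-1:(ZMod 3)ˣ)^(3:ℤ)) = -1 from rfl]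
    have : ex 2 2 (3*i+1) = 3 * (6 * i * i + 4 * i).toNat + 2 := by
      have h1 := ex_spec 2 2 (3*i+1)
      zify; rw [hr]; push_cast at *; linarith
    rw [this, pow_add]; simp; ring
  · have := (Equiv.addRight (1:ℤ)).hasSum_iff.2 (hasSum_neg hr3.neg)
    convert! this using 1
    · funext i
      simp only [Function.comp, Equiv.coe_addRight]
      rw [hc, term, zpow_neg, eps_sq, zpow_add_one, zpow_add, zpow_mul, show ((-1:(ZMod 3)ˣ)^(3:ℤ)) = -1 from rfl,
        show ((-1:(ZMod 3)ˣ)^(2:ℤ)) = 1 from rfl]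
      have : ex 2 2 (3*i+2) = 3 * (6 * (-(i+1)) * (-(i+1)) + 4 * (-(i+1))).toNat + 2 := by
        have h1 := ex_spec 2 2 (3*i+2)
        zify; rw [hr]; push_cast at *; linarith
      rw [this, pow_add]; simp; ring


lemma cube_eq (F : S) : F^3 = PowerSeries.expand 3 (by norm_num) F := by
  have := MvPowerSeries.map_frobenius_expand (R := ZMod 3) (σ := Unit) 3 (by norm_num) (f := F)
  rw [ZMod.frobenius_zmod] at this
  rw [MvPowerSeries.map_id] at this
  exact this.symm

noncomputable def U (i : ℕ) (F : S) : S := PowerSeries.mk fun n => coeff (3*n+i) F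

lemma U_dec {F P Q R : S} (h : F = P^3 + X * Q^3 + X^2 * R^3) :
    U 0 F = P ∧ U 1 F = Q ∧ U 2 F = R := by
  rw [cube_eq, cube_eq, cube_eq] at h
  subst h
  have hX : ∀ (G : S) n, coeff (n+1) (X * G) = coeff n G := fun G n => coeff_succ_X_mul n G
  have hX0 : ∀ (G : S) n, n % 3 = 0 → coeff n (X * expand 3 (by norm_num) G) = 0 := by
    intro G n hn
    cases n with
    | zero => simp
    | succ n => rw [hX, coeff_expand_of_not_dvd]; omega
  have hXX0 : ∀ (G : S) n, n % 3 = 0 → coeff n (X^2 * expand 3 (by norm_num) G) = 0 := by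
    intro G n hn
    rw [pow_two, mul_assoc]
    rcases n with _ | _ | n
    · simp
    · omega
    · rw [hX, hX, coeff_expand_of_not_dvd]; omega
  have hXX1 : ∀ (G : S) n, n % 3 = 0 → coeff (n+1) (X^2 * expand 3 (by norm_num) G) = 0 := by
    intro G n hn
    rw [pow_two, mul_assoc, hX, hX0 _ _ hn]
  refine ⟨?_, ?_, ?_⟩ <;> ext n <;> simp only [U, coeff_mk, map_add]
  · rw [hX0 _ _ (by omega), hXX0 _ _ (by omega), Nat.add_zero, coeff_expand_mul]; simp
  · rw [hXX1 _ _ (by omega), hX, coeff_expand_mul, coeff_expand_of_not_dvd _ _ _ (by omega)]; simp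
  · rw [show 3*n+2 = 3*n+1+1 by ring, hX, coeff_expand_of_not_dvd _ _ _ (by omega), pow_two, mul_assoc, hX, hX,
      coeff_expand_mul, coeff_expand_of_not_dvd _ _ _ (by omega)]; simp

lemma E_isUnit (ε : ZMod 3) (a c : ℕ) (ha : 0 < a) (hc : 0 < c) : IsUnit (E ε a c) := by
  rw [PowerSeries.isUnit_iff_constantCoeff, E_const ε a c ha hc]; exact isUnit_one

noncomputable def mm (u : Sˣ × Sˣ × Sˣ) (a b c : ℤ) : S := ((u.1^a * u.2.1^b * u.2.2^c : Sˣ) : S)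

lemma mm_mul (u : Sˣ × Sˣ × Sˣ) (a b c a' b' c' : ℤ) :
    mm u a b c * mm u a' b' c' = mm u (a+a') (b+b') (c+c') := by
  unfold mm
  rw [← Units.val_mul]; congr 1
  rw [zpow_add, zpow_add, zpow_add]
  simp only [mul_assoc, mul_left_comm, mul_comm]

lemma mm_pow (u : Sˣ × Sˣ × Sˣ) (a b c : ℤ) (n : ℕ) :
    mm u a b c ^ n = mm u (n*a) (n*b) (n*c) := by
  unfold mm
  rw [← Units.val_pow_eq_pow_val]; congr 1
  rw [mul_pow, mul_pow, mul_comm (n:ℤ), mul_comm (n:ℤ), mul_comm (n:ℤ)]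
  simp only [zpow_mul, zpow_natCast]

lemma main_alg (u : Sˣ × Sˣ × Sˣ) (G R : S)
    (hG : G = mm u (-1) 2 0 * mm u 0 0 (-3))
    (hψ : mm u (-1) 2 0 = (mm u 5 (-2) 0)^3 + X * (mm u (-1) 2 0)^9)
    (hφ : mm u (-2) 5 (-2) = (mm u (-2) 5 (-2))^9 - X * (mm u 2 (-1) 2)^3)
    (hP : mm u 0 2 (-1) = (mm u 0 2 (-1))^9 + X^2 * R^3) :
    U 0 (U 2 (U 2 (U 0 G))) = - U 1 (U 0 G) := by
  have h3 : (3:S) = 0 := by exact_mod_cast CharP.cast_eq_zero S 3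
  have hC : U 0 G = mm u 5 (-2) (-1) := by
    refine (U_dec (P := mm u 5 (-2) (-1)) (Q := mm u (-1) 2 0 ^ 3 * mm u 0 0 (-1)) (R := 0) ?_).1
    rw [hG]
    have e : mm u 0 0 (-3) = mm u 0 0 (-1) ^ 3 := by rw [mm_pow]; norm_num
    have e' : mm u 5 (-2) (-1) = mm u 5 (-2) 0 * mm u 0 0 (-1) := by rw [mm_mul]; norm_num
    rw [e, e']; linear_combination mm u 0 0 (-1) ^ 3 * hψ
  rw [hC]
  have hφ2 : (mm u (-2) 5 (-2))^2 = ((mm u (-2) 5 (-2))^6)^3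
      + X * ((mm u (-2) 5 (-2))^3 * mm u 2 (-1) 2)^3 + X^2 * ((mm u 2 (-1) 2)^2)^3 := by
    generalize mm u (-2) 5 (-2) = p at *
    generalize mm u 2 (-1) 2 = b at *
    have : p^2 = (p^9 - X*b^3)^2 := by rw [← hφ]
    rw [this]
    linear_combination (-X * p^9 * b^3) * h3
  have d1 := U_dec (F := mm u 5 (-2) (-1)) (P := (mm u (-2) 5 (-2))^6 * mm u 3 (-4) 1)
    (Q := (mm u (-2) 5 (-2))^3 * mm u 2 (-1) 2 * mm u 3 (-4) 1)
    (R := (mm u 2 (-1) 2)^2 * mm u 3 (-4) 1) (by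
      have e : mm u 5 (-2) (-1) = (mm u (-2) 5 (-2))^2 * mm u 3 (-4) 1 ^ 3 := by
        rw [mm_pow, mm_pow, mm_mul]; norm_num
      rw [e, hφ2]; ring)
  rw [d1.2.1, d1.2.2]
  have d2 := U_dec (F := (mm u 2 (-1) 2)^2 * mm u 3 (-4) 1)
    (P := ((mm u (-2) 5 (-2))^6 * mm u 5 (-2) 0 + X * (mm u 2 (-1) 2)^2 * (mm u (-1) 2 0)^3) * mm u 4 (-6) 3)
    (Q := ((mm u (-2) 5 (-2))^3 * mm u 2 (-1) 2 * mm u 5 (-2) 0 + (mm u (-2) 5 (-2))^6 * (mm u (-1) 2 0)^3) * mm u 4 (-6) 3)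
    (R := ((mm u 2 (-1) 2)^2 * mm u 5 (-2) 0 + (mm u (-2) 5 (-2))^3 * mm u 2 (-1) 2 * (mm u (-1) 2 0)^3) * mm u 4 (-6) 3) (by
      have e : (mm u 2 (-1) 2)^2 * mm u 3 (-4) 1 = (mm u (-2) 5 (-2))^2 * mm u (-1) 2 0 * mm u 4 (-6) 3 ^ 3 := by
        rw [mm_pow, mm_pow, mm_pow, mm_mul, mm_mul, mm_mul]; norm_num
      rw [e, hφ2]
      generalize mm u (-2) 5 (-2) = p at *
      generalize mm u 2 (-1) 2 = b at *
      generalize mm u (-1) 2 0 = s at *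
      generalize mm u 5 (-2) 0 = t at *
      generalize mm u 4 (-6) 3 = k at *
      rw [add_mul _ _ k, add_mul _ _ k, add_mul _ _ k, add_pow_char, add_pow_char, add_pow_char]
      linear_combination ((p^6)^3 + X * (p^3 * b)^3 + X^2 * (b^2)^3) * k^3 * hψ)
  rw [d2.2.2]
  have d3 := U_dec (F := ((mm u 2 (-1) 2)^2 * mm u 5 (-2) 0 + (mm u (-2) 5 (-2))^3 * mm u 2 (-1) 2 * (mm u (-1) 2 0)^3) * mm u 4 (-6) 3)
    (P := (mm u (-2) 5 (-2))^3 * mm u 5 (-5) 3 + (mm u 0 2 (-1))^3 * (mm u (-2) 5 (-2) * mm u (-1) 2 0 * mm u 2 (-3) 2))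
    (Q := - mm u 2 (-1) 2 * mm u 5 (-5) 3)
    (R := R * (mm u (-2) 5 (-2) * mm u (-1) 2 0 * mm u 2 (-3) 2)) (by
      have e : ((mm u 2 (-1) 2)^2 * mm u 5 (-2) 0 + (mm u (-2) 5 (-2))^3 * mm u 2 (-1) 2 * (mm u (-1) 2 0)^3) * mm u 4 (-6) 3
         = mm u (-2) 5 (-2) * mm u 5 (-5) 3 ^ 3 + mm u 0 2 (-1) * (mm u (-2) 5 (-2) * mm u (-1) 2 0 * mm u 2 (-3) 2)^3 := by
        rw [add_mul]
        simp only [mm_pow, mm_mul]; norm_num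
      rw [e, add_pow_char]
      linear_combination mm u 5 (-5) 3 ^ 3 * hφ + (mm u (-2) 5 (-2) * mm u (-1) 2 0 * mm u 2 (-3) 2)^3 * hP)
  rw [d3.1]
  simp only [mm_pow, mm_mul]
  norm_num
  linear_combination mm u (-1) 10 (-3) * h3

lemma final_alg (G : S) (hG : G * E (-1) 4 4 ^ 2 = E 1 1 2) :
    U 0 (U 2 (U 2 (U 0 G))) = - U 1 (U 0 G) := by
  obtain ⟨u1, h1⟩ := E_isUnit (-1) 1 1 (by norm_num) (by norm_num)
  obtain ⟨u2, h2⟩ := E_isUnit (-1) 2 2 (by norm_num) (by norm_num)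
  obtain ⟨u4, h4⟩ := E_isUnit (-1) 4 4 (by norm_num) (by norm_num)
  obtain ⟨e, he⟩ := E_isUnit 1 1 2 (by norm_num) (by norm_num)
  obtain ⟨d, hd⟩ := E_isUnit 1 1 1 (by norm_num) (by norm_num)
  obtain ⟨w, hw⟩ := E_isUnit (-1) 2 4 (by norm_num) (by norm_num)
  have r1 : e * u1 * u4 = u2^2 := by
    have a1 := E_split2 (-1) 1 1 (by norm_num)
    have a2 := E_split2 (-1) 2 2 (by norm_num)
    have a3 := E_pm 1 2 (by norm_num)
    norm_num at a1 a2 a3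
    ext1
    push_cast
    rw [he, h1, h4, h2]
    linear_combination E 1 1 2 * E (-1) 4 4 * a1 + E (-1) 2 2 * E (-1) 4 4 * a3 - E (-1) 2 2 * a2
  have r2 : d * u1 = u2 := by
    have a3 := E_pm 1 1 (by norm_num)
    norm_num at a3
    ext1
    push_cast
    rw [hd, h1, h2, a3]
  have r3 : w * u4 = u2 := by
    have a2 := E_split2 (-1) 2 2 (by norm_num)
    norm_num at a2
    ext1
    push_cast
    rw [hw, h4, h2, a2]
  have e' : e = u1^(-1:ℤ) * u2^(2:ℤ) * u4^(-1:ℤ) := by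
    rw [zpow_neg_one, zpow_neg_one, _root_.eq_mul_inv_iff_mul_eq, eq_inv_mul_iff_mul_eq, zpow_ofNat, ← r1]
    simp only [mul_comm, mul_left_comm]
  have d' : d = u1^(-1:ℤ) * u2^(1:ℤ) * u4^(0:ℤ) := by
    rw [← r2]; simp
  have w' : w = u1^(0:ℤ) * u2^(1:ℤ) * u4^(-1:ℤ) := by
    rw [← r3]; simp
  obtain ⟨u, hu⟩ : ∃ u, u = (u1, u2, u4) := ⟨_, rfl⟩
  have me : E 1 1 2 = mm u (-1) 2 (-1) := by rw [← he, e', hu]; rfl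
  have md : E 1 1 1 = mm u (-1) 1 0 := by rw [← hd, d', hu]; rfl
  have mw : E (-1) 2 4 = mm u 0 1 (-1) := by rw [← hw, w', hu]; rfl
  have m1 : E (-1) 1 1 = mm u 1 0 0 := by rw [← h1, hu]; simp [mm]
  have m2 : E (-1) 2 2 = mm u 0 1 0 := by rw [← h2, hu]; simp [mm]
  have m4 : E (-1) 4 4 = mm u 0 0 1 := by rw [← h4, hu]; simp [mm]
  have one : mm u 0 0 0 = 1 := by simp [mm]
  -- theta functions
  have tψ : Th 1 1 3 = mm u (-1) 2 0 := by
    have a := E_split2 1 1 2 (by norm_num)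
    norm_num at a
    unfold Th
    norm_num
    rw [← a, me, m4, mm_mul]; norm_num
  have tφ : Th 1 1 1 = mm u (-2) 5 (-2) := by
    unfold Th
    norm_num
    rw [me, m2, mm_mul, mm_mul]; norm_num
  have tP : Th (-1) 2 2 = mm u 0 2 (-1) := by
    unfold Th
    norm_num
    rw [mw, m4, mm_mul, mm_mul]; norm_num
  have tA : Th 1 1 2 = mm u 5 (-2) 0 := by
    have a := E_split3 1 1 1 (by norm_num)
    have c1 := E_cube 1 1 1 (by norm_num)
    have c2 := E_cube (-1) 1 1 (by norm_num)
    norm_num at a c1 c2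
    unfold Th
    norm_num
    rw [c2, m1]
    rw [c1, md] at a
    have : E 1 1 3 * E 1 2 3 = mm u 2 (-2) 0 := by
      have h := congrArg (· * mm u 3 (-3) 0) a
      simp only [mm_pow, mul_assoc, mm_mul] at h
      norm_num at h
      rw [one] at h
      rw [h]; ring
    rw [this, mm_pow, mm_mul]; norm_num
  have tB : Th 1 1 5 = mm u 2 (-1) 2 := by
    have a := E_split3 1 1 2 (by norm_num)
    have c1 := E_cube 1 1 2 (by norm_num)
    have c2 := E_cube (-1) 2 2 (by norm_num)
    norm_num at a c1 c2
    unfold Th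
    norm_num
    rw [c2, m2]
    rw [c1, me] at a
    have : E 1 1 6 * E 1 5 6 = mm u 2 (-4) 2 := by
      have h := congrArg (· * mm u 3 (-6) 3) a
      rw [mul_right_comm (E 1 1 6)] at h
      simp only [mm_pow, mul_assoc, mm_mul] at h
      norm_num at h
      rw [one] at h
      rw [h]; ring
    rw [this, mm_pow, mm_mul]; norm_num
  obtain ⟨R, hR⟩ := P2_dis
  refine main_alg u G R ?_ ?_ ?_ ?_
  · rw [m4, me] at hG
    have h := congrArg (· * mm u 0 0 (-2)) hG
    simp only [mm_pow, mul_assoc, mm_mul] at h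
    norm_num at h
    rw [one] at h
    rw [mm_mul]; norm_num
    rw [← h, mul_one]
  · rw [← tψ, ← tA]; exact psi_dis
  · rw [← tφ, ← tB]; exact phi_dis
  · rw [← tP]; exact hR

def PA (m : Multiset ℕ) : Prop := m.Nodup ∧ ∀ x ∈ m, Odd x
def PB (m : Multiset ℕ) : Prop := ∀ x ∈ m, 0 < x ∧ 4 ∣ x

noncomputable def cnt (P : Multiset ℕ → Prop) (n : ℕ) : ℕ :=
  Nat.card {m : Multiset ℕ // m.sum = n ∧ P m}

def partEquiv (P : Multiset ℕ → Prop) (hP : ∀ m, P m → ∀ x ∈ m, 0 < x) (n : ℕ) :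
    {m : Multiset ℕ // m.sum = n ∧ P m} ≃ {p : n.Partition // P p.parts} where
  toFun m := ⟨⟨m.1, fun {x} hx => hP m.1 m.2.2 x hx, m.2.1⟩, m.2.2⟩
  invFun p := ⟨p.1.parts, p.1.parts_sum, p.2⟩
  left_inv _ := rfl
  right_inv _ := rfl

open Classical in
lemma cnt_eq (P : Multiset ℕ → Prop) (hP : ∀ m, P m → ∀ x ∈ m, 0 < x) (n : ℕ) :
    cnt P n = (Finset.univ.filter fun p : n.Partition => P p.parts).card := by
  rw [cnt, Nat.card_congr (partEquiv P hP n), Nat.card_eq_fintype_card, Fintype.card_subtype]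

lemma fin_of (P : Multiset ℕ → Prop) (hP : ∀ m, P m → ∀ x ∈ m, 0 < x) (n : ℕ) :
    Finite {m : Multiset ℕ // m.sum = n ∧ P m} :=
  Finite.of_equiv _ (partEquiv P hP n).symm

lemma PA_pos : ∀ m, PA m → ∀ x ∈ m, 0 < x := fun _ h x hx => (h.2 x hx).pos
lemma PB_pos : ∀ m, PB m → ∀ x ∈ m, 0 < x := fun _ h x hx => (h x hx).1

def convEquiv {α β : Type} (w : α → ℕ) (v : β → ℕ) (P : α → Prop) (Q : β → Prop) (n : ℕ) :
    {t : α × β // w t.1 + v t.2 = n ∧ P t.1 ∧ Q t.2} ≃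
      (Σ ij : Finset.HasAntidiagonal.antidiagonal n, {x : α // w x = ij.1.1 ∧ P x} × {y : β // v y = ij.1.2 ∧ Q y}) where
  toFun t := ⟨⟨(w t.1.1, v t.1.2), Finset.HasAntidiagonal.mem_antidiagonal.2 t.2.1⟩, ⟨t.1.1, rfl, t.2.2.1⟩, ⟨t.1.2, rfl, t.2.2.2⟩⟩
  invFun s := ⟨(s.2.1.1, s.2.2.1), by
    rw [s.2.1.2.1, s.2.2.2.1]; exact Finset.HasAntidiagonal.mem_antidiagonal.1 s.1.2, s.2.1.2.2, s.2.2.2.2⟩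
  left_inv _ := rfl
  right_inv := by
    rintro ⟨⟨⟨i, j⟩, hij⟩, ⟨x, hx, hx'⟩, ⟨y, hy, hy'⟩⟩
    dsimp only at hx hy
    subst hx; subst hy
    rfl

lemma conv_card {α β : Type} (w : α → ℕ) (v : β → ℕ) (P : α → Prop) (Q : β → Prop)
    (hf : ∀ i, Finite {x : α // w x = i ∧ P x}) (hg : ∀ i, Finite {x : β // v x = i ∧ Q x}) (n : ℕ) :
    Finite {t : α × β // w t.1 + v t.2 = n ∧ P t.1 ∧ Q t.2} ∧
    Nat.card {t : α × β // w t.1 + v t.2 = n ∧ P t.1 ∧ Q t.2} =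
    ∑ ij ∈ Finset.HasAntidiagonal.antidiagonal n, Nat.card {x : α // w x = ij.1 ∧ P x} * Nat.card {y : β // v y = ij.2 ∧ Q y} := by
  constructor
  · exact Finite.of_equiv _ (convEquiv w v P Q n).symm
  · rw [Nat.card_congr (convEquiv w v P Q n), Nat.card_sigma]
    simp only [Nat.card_prod]
    exact Finset.sum_coe_sort (Finset.HasAntidiagonal.antidiagonal n) (fun ij => Nat.card {x : α // w x = ij.1 ∧ P x} * Nat.card {y : β // v y = ij.2 ∧ Q y})

noncomputable def gen (P : Multiset ℕ → Prop) : S := PowerSeries.mk fun n => (cnt P n : ZMod 3)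

lemma bTriple_gen : (PowerSeries.mk fun n => (bTriple n : ZMod 3)) = gen PA * (gen PB * gen PB) := by
  have hA := fin_of PA PA_pos
  have hB := fin_of PB PB_pos
  have h1 := conv_card (Multiset.sum (M := ℕ)) (Multiset.sum (M := ℕ)) PB PB hB hB
  have h2 := conv_card (Multiset.sum (M := ℕ)) (fun t : Multiset ℕ × Multiset ℕ => t.1.sum + t.2.sum) PA
    (fun t => PB t.1 ∧ PB t.2) hA (fun i => (h1 i).1)
  ext n
  have e : bTriple n = Nat.card {t : Multiset ℕ × (Multiset ℕ × Multiset ℕ) // t.1.sum + (t.2.1.sum + t.2.2.sum) = n ∧ PA t.1 ∧ (PB t.2.1 ∧ PB t.2.2)} := by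
    unfold bTriple
    refine Nat.card_congr (Equiv.subtypeEquivRight ?_)
    intro t
    unfold PA PB
    rw [add_assoc]
    tauto
  simp only [gen, coeff_mul, coeff_mk]
  rw [e, (h2 n).2]
  push_cast
  refine Finset.sum_congr rfl fun ij _ => ?_
  rw [(h1 ij.2).2]
  push_cast
  rfl

lemma genB : gen PB * E (-1) 4 4 = 1 := by
  have h := Nat.Partition.hasProd_powerSeriesMk_card_restricted (ZMod 3) (fun x => 4 ∣ x)
  have e : gen PB = PowerSeries.mk fun n ↦ ((Nat.Partition.restricted n (fun x => 4 ∣ x)).card : ZMod 3) := by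
    ext n
    simp only [gen, coeff_mk]
    rw [cnt_eq PB PB_pos]
    congr 1
    apply congrArg Finset.card
    ext p
    classical
    unfold Nat.Partition.restricted
    rw [Finset.mem_filter, Finset.mem_filter]
    constructor
    · rintro ⟨h, h1⟩; exact ⟨h, fun i hi => (h1 i hi).2⟩
    · rintro ⟨h, h1⟩; exact ⟨h, fun i hi => ⟨p.parts_pos hi, h1 i hi⟩⟩
  rw [← e] at h
  have h1 := h.tendsto_prod_nat.comp (tendsto_id.const_mul_atTop' (show 0 < 4 by norm_num))
  have h2 := h1.mul (E_tendsto (-1) 4 4 (by norm_num))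
  refine tendsto_nhds_unique h2 (tendsto_const_nhds.congr ?_)
  intro N
  simp only [Function.comp, id]
  induction N with
  | zero => simp
  | succ N ih =>
    rw [Nat.mul_succ]
    rw [Finset.prod_range_succ, Finset.prod_range_succ, Finset.prod_range_succ, Finset.prod_range_succ, Finset.prod_range_succ]
    rw [if_neg (by omega), if_neg (by omega), if_neg (by omega), if_pos (by omega)]
    have := WithPiTopology.tsum_pow_mul_one_sub_of_constantCoeff_eq_zero (f := (X : S)^(4*N+3+1)) (by simp)
    simp only [← pow_mul] at this
    have e : fac (-1) 4 4 N = 1 - X^(4*N+3+1) := by simp [fac]; ring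
    rw [e]
    linear_combination ih - (∏ x ∈ Finset.range (4 * N), if 4 ∣ x + 1 then ∑' (j : ℕ), X ^ ((x + 1) * j) else 1) * (∏ n ∈ Finset.range N, fac (-1) 4 4 n) * this

open Classical in
lemma genA : gen PA = E 1 1 2 := by
  have h := Nat.Partition.hasProd_genFun (fun i c => if Odd i ∧ c = 1 then (1 : ZMod 3) else 0)
  have e : gen PA = Nat.Partition.genFun (fun i c => if Odd i ∧ c = 1 then (1 : ZMod 3) else 0) := by
    ext n
    simp only [gen, coeff_mk, Nat.Partition.coeff_genFun]
    rw [cnt_eq PA PA_pos, Finset.card_filter]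
    push_cast
    refine Finset.sum_congr rfl fun p _ => ?_
    rw [Finsupp.prod, Finset.prod_boole]
    congr 1
    simp only [PA, Multiset.toFinsupp_support, Multiset.mem_toFinset, Multiset.toFinsupp_apply, eq_iff_iff]
    constructor
    · rintro ⟨h1, h2⟩ i hi
      exact ⟨h2 i hi, Multiset.count_eq_one_of_mem h1 hi⟩
    · intro h
      refine ⟨Multiset.nodup_iff_count_le_one.2 fun i => ?_, fun i hi => (h i hi).1⟩
      by_cases hi : i ∈ p.parts
      · exact (h i hi).2.le
      · rw [Multiset.count_eq_zero_of_notMem hi]; omega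
  rw [← e] at h
  have hf : ∀ i : ℕ, (1 + ∑' j : ℕ, (if Odd (i+1) ∧ j + 1 = 1 then (1 : ZMod 3) else 0) • (X:S) ^ ((i + 1) * (j + 1)))
      = if Odd (i+1) then 1 + X^(i+1) else 1 := by
    intro i
    rw [tsum_eq_single 0 (by intro j hj; simp [hj])]
    split_ifs with h1 h2 <;> simp_all
  simp only [hf] at h
  have h1 := h.tendsto_prod_nat.comp (tendsto_id.const_mul_atTop' (show 0 < 2 by norm_num))
  refine tendsto_nhds_unique h1 ((E_tendsto 1 1 2 (by norm_num)).congr ?_)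
  intro N
  simp only [Function.comp, id]
  induction N with
  | zero => simp
  | succ N ih =>
    rw [Nat.mul_succ]
    rw [Finset.prod_range_succ, Finset.prod_range_succ, Finset.prod_range_succ]
    rw [if_pos ⟨N, rfl⟩, if_neg (by rw [Nat.not_odd_iff_even]; exact ⟨N+1, by ring⟩), ih]
    simp [fac]

end BT

/-- `b(81n+24) ≡ -b(9n+3) (mod 3)` for all `n ≥ 0`. -/
theorem bTriple_81n_add_24_congruence (n : ℕ) :
    (bTriple (81 * n + 24) : ℤ) ≡ -(bTriple (9 * n + 3) : ℤ) [ZMOD 3] := by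
  have h := BT.final_alg (PowerSeries.mk fun n => (bTriple n : ZMod 3)) (by
    rw [BT.bTriple_gen, BT.genA]
    linear_combination BT.E 1 1 2 * (BT.gen BT.PB * BT.E (-1) 4 4 + 1) * BT.genB)
  have h' := congrArg (coeff n) h
  simp only [BT.U, coeff_mk, map_neg] at h'
  rw [show 3 * (3 * (3 * (3 * n + 0) + 2) + 2) + 0 = 81 * n + 24 by ring,
    show 3 * (3 * n + 1) + 0 = 9 * n + 3 by ring] at h'
  have := (ZMod.intCast_eq_intCast_iff (bTriple (81 * n + 24)) (-(bTriple (9 * n + 3) : ℤ)) 3).1 (by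
    push_cast; exact h')
  exact_mod_cast this
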